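/- Suppose the ring extension A|B admits a right D2 quasibase γ_j ∈ S, u_j ∈ T. Realize S ⊗_R S ⊗_R E as the quotient of S ⊗_ℤ S ⊗_ℤ E by the subgroups generated by the relations α(−)r ⊗ β ⊗ f − α ⊗ r·β(−) ⊗ f and α ⊗ β(−)r ⊗ f − α ⊗ β ⊗ r·f(−) for r ∈ R, and realize A⊗_B A⊗_B A as the quotient of A⊗_ℤ A⊗_ℤ A by the B-balancing relations in both middle positions. Then the map S ⊗_R S ⊗_R E → Hom(_B A⊗_B A⊗_B A, _B A) sending α⊗β⊗f to the map induced by a⊗a′⊗a″ ↦ α(a)β(a′)f(a″) is well defined and bijective. -/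

import Mathlib

noncomputable section

open TensorProduct

variable (A : Type*) [Ring A] (B : Subring A)

/-- The `B`-balancing relations in `A ⊗_ℤ A`, realizing `A ⊗_B A` as a quotient of the
tensor product of abelian groups. -/
def relB : AddSubgroup (A ⊗[ℤ] A) :=
  AddSubgroup.closure {z | ∃ a a' b : A, b ∈ B ∧ z = (a * b) ⊗ₜ[ℤ] a' - a ⊗ₜ[ℤ] (b * a')}

/-- `A ⊗_B A`. -/
abbrev QB := (A ⊗[ℤ] A) ⧸ relB A B

/-- The canonical quotient map `A ⊗_ℤ A → A ⊗_B A`. -/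
def mkB : A ⊗[ℤ] A →+ QB A B := QuotientAddGroup.mk' _

theorem lmul_aux (c : A) :
    relB A B ≤ (relB A B).comap (LinearMap.rTensor A (LinearMap.mulLeft ℤ c)).toAddMonoidHom := by
  rw [relB, AddSubgroup.closure_le]
  rintro z ⟨a, a', b, hb, rfl⟩
  simp only [SetLike.mem_coe, AddSubgroup.mem_comap, LinearMap.toAddMonoidHom_coe, map_sub,
    LinearMap.rTensor_tmul, LinearMap.mulLeft_apply]
  rw [← mul_assoc]
  exact AddSubgroup.subset_closure ⟨c * a, a', b, hb, rfl⟩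

theorem rmul_aux (c : A) :
    relB A B ≤ (relB A B).comap (LinearMap.lTensor A (LinearMap.mulRight ℤ c)).toAddMonoidHom := by
  rw [relB, AddSubgroup.closure_le]
  rintro z ⟨a, a', b, hb, rfl⟩
  simp only [SetLike.mem_coe, AddSubgroup.mem_comap, LinearMap.toAddMonoidHom_coe, map_sub,
    LinearMap.lTensor_tmul, LinearMap.mulRight_apply]
  rw [mul_assoc]
  exact AddSubgroup.subset_closure ⟨a, a' * c, b, hb, rfl⟩

/-- The left `A`-action on `A ⊗_B A` through the left tensorand. -/
def lmulB (c : A) : QB A B →+ QB A B :=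
  QuotientAddGroup.map _ _ (LinearMap.rTensor A (LinearMap.mulLeft ℤ c)).toAddMonoidHom
    (lmul_aux A B c)

/-- The right `A`-action on `A ⊗_B A` through the right tensorand. -/
def rmulB (c : A) : QB A B →+ QB A B :=
  QuotientAddGroup.map _ _ (LinearMap.lTensor A (LinearMap.mulRight ℤ c)).toAddMonoidHom
    (rmul_aux A B c)

/-- `E = End(_B A)`: the left `B`-linear additive endomorphisms of `A`. -/
def Egrp : AddSubgroup (A →+ A) where
  carrier := {f | ∀ b ∈ B, ∀ a : A, f (b * a) = b * f a}
  add_mem' := by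
    intro f g hf hg b hb a
    simp [hf b hb a, hg b hb a, mul_add]
  zero_mem' := by intro b hb a; simp
  neg_mem' := by
    intro f hf b hb a
    simp [hf b hb a]

/-- `S = End(_B A_B)`: the `B`-`B`-bilinear additive endomorphisms of `A`. -/
def Sgrp : AddSubgroup (A →+ A) where
  carrier := {f | ∀ b ∈ B, ∀ a : A, f (b * a) = b * f a ∧ f (a * b) = f a * b}
  add_mem' := by
    intro f g hf hg b hb a
    exact ⟨by simp [(hf b hb a).1, (hg b hb a).1, mul_add],
      by simp [(hf b hb a).2, (hg b hb a).2, add_mul]⟩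
  zero_mem' := by intro b hb a; simp
  neg_mem' := by
    intro f hf b hb a
    exact ⟨by simp [(hf b hb a).1], by simp [(hf b hb a).2]⟩

/-- `Hom(_B A ⊗_B A, _B A)`: additive maps `A ⊗_B A → A` which are left `B`-linear for the
`B`-action through the left tensorand. -/
def HomBQ : AddSubgroup (QB A B →+ A) where
  carrier := {F | ∀ b ∈ B, ∀ q : QB A B, F (lmulB A B b q) = b * F q}
  add_mem' := by
    intro F G hF hG b hb q
    simp [hF b hb q, hG b hb q, mul_add]
  zero_mem' := by intro b hb q; simp
  neg_mem' := by
    intro F hF b hb q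
    simp [hF b hb q]

/-- The `B`-balancing relations in both middle positions of `A ⊗_ℤ A ⊗_ℤ A`, realizing
`A ⊗_B A ⊗_B A`. -/
def relB3 : AddSubgroup (A ⊗[ℤ] (A ⊗[ℤ] A)) :=
  AddSubgroup.closure
    {z | (∃ a a' a'' b : A, b ∈ B ∧
            z = (a * b) ⊗ₜ[ℤ] (a' ⊗ₜ[ℤ] a'') - a ⊗ₜ[ℤ] ((b * a') ⊗ₜ[ℤ] a'')) ∨
         (∃ a a' a'' b : A, b ∈ B ∧
            z = a ⊗ₜ[ℤ] ((a' * b) ⊗ₜ[ℤ] a'') - a ⊗ₜ[ℤ] (a' ⊗ₜ[ℤ] (b * a'')))}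

/-- `A ⊗_B A ⊗_B A`. -/
abbrev QB3 := (A ⊗[ℤ] (A ⊗[ℤ] A)) ⧸ relB3 A B

/-- The canonical quotient map onto `A ⊗_B A ⊗_B A`. -/
def mkB3 : A ⊗[ℤ] (A ⊗[ℤ] A) →+ QB3 A B := QuotientAddGroup.mk' _

theorem lmul3_aux (c : A) :
    relB3 A B ≤ (relB3 A B).comap
      (LinearMap.rTensor (A ⊗[ℤ] A) (LinearMap.mulLeft ℤ c)).toAddMonoidHom := by
  rw [relB3, AddSubgroup.closure_le]
  rintro z (⟨a, a', a'', b, hb, rfl⟩ | ⟨a, a', a'', b, hb, rfl⟩) <;>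
    simp only [SetLike.mem_coe, AddSubgroup.mem_comap, LinearMap.toAddMonoidHom_coe, map_sub,
      LinearMap.rTensor_tmul, LinearMap.mulLeft_apply]
  · rw [← mul_assoc]
    exact AddSubgroup.subset_closure (Or.inl ⟨c * a, a', a'', b, hb, rfl⟩)
  · exact AddSubgroup.subset_closure (Or.inr ⟨c * a, a', a'', b, hb, rfl⟩)

/-- The left `A`-action on `A ⊗_B A ⊗_B A` through the left tensorand. -/
def lmulB3 (c : A) : QB3 A B →+ QB3 A B :=
  QuotientAddGroup.map _ _
    (LinearMap.rTensor (A ⊗[ℤ] A) (LinearMap.mulLeft ℤ c)).toAddMonoidHom (lmul3_aux A B c)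

/-- `Hom(_B A ⊗_B A ⊗_B A, _B A)`. -/
def HomBQ3 : AddSubgroup (QB3 A B →+ A) where
  carrier := {F | ∀ b ∈ B, ∀ q : QB3 A B, F (lmulB3 A B b q) = b * F q}
  add_mem' := by
    intro F G hF hG b hb q
    simp [hF b hb q, hG b hb q, mul_add]
  zero_mem' := by intro b hb q; simp
  neg_mem' := by
    intro F hF b hb q
    simp [hF b hb q]

/-- The `R`-balancing relations in both middle positions of `S ⊗_ℤ S ⊗_ℤ E`:
`α(−)r ⊗ β ⊗ f − α ⊗ r·β(−) ⊗ f` and `α ⊗ β(−)r ⊗ f − α ⊗ β ⊗ r·f(−)`. -/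
def relSSE : AddSubgroup (↥(Sgrp A B) ⊗[ℤ] (↥(Sgrp A B) ⊗[ℤ] ↥(Egrp A B))) :=
  AddSubgroup.closure
    {z | (∃ (α α' β β' : ↥(Sgrp A B)) (f : ↥(Egrp A B)) (r : A),
            r ∈ Set.centralizer (B : Set A) ∧
            (∀ a : A, (α' : A →+ A) a = (α : A →+ A) a * r) ∧
            (∀ a : A, (β' : A →+ A) a = r * (β : A →+ A) a) ∧
            z = α' ⊗ₜ[ℤ] (β ⊗ₜ[ℤ] f) - α ⊗ₜ[ℤ] (β' ⊗ₜ[ℤ] f)) ∨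
         (∃ (α β β' : ↥(Sgrp A B)) (f f' : ↥(Egrp A B)) (r : A),
            r ∈ Set.centralizer (B : Set A) ∧
            (∀ a : A, (β' : A →+ A) a = (β : A →+ A) a * r) ∧
            (∀ a : A, (f' : A →+ A) a = r * (f : A →+ A) a) ∧
            z = α ⊗ₜ[ℤ] (β' ⊗ₜ[ℤ] f) - α ⊗ₜ[ℤ] (β ⊗ₜ[ℤ] f'))}

section

variable {A B}

/-- The additive map out of a tensor product of abelian groups induced by a biadditive function. -/
def liftBiadditive {M N X : Type*} [AddCommGroup M] [AddCommGroup N] [AddCommGroup X]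
    (h : M → N → X) (h₁ : ∀ m m' n, h (m + m') n = h m n + h m' n)
    (h₂ : ∀ m n n', h m (n + n') = h m n + h m n') : M ⊗[ℤ] N →+ X :=
  TensorProduct.liftAddHom
    (AddMonoidHom.mk' (fun m => AddMonoidHom.mk' (h m) (h₂ m))
      (fun m m' => AddMonoidHom.ext (h₁ m m')))
    (fun r m n => by
      rw [map_zsmul, map_zsmul]
      rfl)

@[simp]
theorem liftBiadditive_tmul {M N X : Type*} [AddCommGroup M] [AddCommGroup N] [AddCommGroup X]
    (h : M → N → X) (h₁ : ∀ m m' n, h (m + m') n = h m n + h m' n)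
    (h₂ : ∀ m n n', h m (n + n') = h m n + h m n') (m : M) (n : N) :
    liftBiadditive h h₁ h₂ (m ⊗ₜ[ℤ] n) = h m n := rfl

/-- The additive map out of a threefold tensor product of abelian groups induced by a
triadditive function. -/
def liftTriadditive {M N P X : Type*} [AddCommGroup M] [AddCommGroup N] [AddCommGroup P]
    [AddCommGroup X] (h : M → N → P → X)
    (h₁ : ∀ m m' n p, h (m + m') n p = h m n p + h m' n p)
    (h₂ : ∀ m n n' p, h m (n + n') p = h m n p + h m n' p)
    (h₃ : ∀ m n p p', h m n (p + p') = h m n p + h m n p') : M ⊗[ℤ] (N ⊗[ℤ] P) →+ X :=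
  liftBiadditive (fun m => liftBiadditive (h m) (h₂ m) (h₃ m))
    (fun m m' t => by
      induction t with
      | zero => simp
      | tmul n p => simp [h₁]
      | add t s ht hs => simp only [map_add, ht, hs]; abel)
    (fun m t s => map_add _ t s)

@[simp]
theorem liftTriadditive_tmul {M N P X : Type*} [AddCommGroup M] [AddCommGroup N] [AddCommGroup P]
    [AddCommGroup X] (h : M → N → P → X)
    (h₁ : ∀ m m' n p, h (m + m') n p = h m n p + h m' n p)
    (h₂ : ∀ m n n' p, h m (n + n') p = h m n p + h m n' p)
    (h₃ : ∀ m n p p', h m n (p + p') = h m n p + h m n p') (m : M) (n : N) (p : P) :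
    liftTriadditive h h₁ h₂ h₃ (m ⊗ₜ[ℤ] (n ⊗ₜ[ℤ] p)) = h m n p := rfl

theorem tensor_addHom_ext {M N X : Type*} [AddCommGroup M] [AddCommGroup N] [AddCommGroup X]
    {F G : M ⊗[ℤ] N →+ X} (h : ∀ m n, F (m ⊗ₜ[ℤ] n) = G (m ⊗ₜ[ℤ] n)) : F = G := by
  ext t
  induction t with
  | zero => simp
  | tmul m n => exact h m n
  | add t s ht hs => simp only [map_add, ht, hs]

theorem tensor_addHom_ext₃ {M N P X : Type*} [AddCommGroup M] [AddCommGroup N] [AddCommGroup P]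
    [AddCommGroup X] {F G : M ⊗[ℤ] (N ⊗[ℤ] P) →+ X}
    (h : ∀ m n p, F (m ⊗ₜ[ℤ] (n ⊗ₜ[ℤ] p)) = G (m ⊗ₜ[ℤ] (n ⊗ₜ[ℤ] p))) : F = G := by
  refine tensor_addHom_ext fun m t => ?_
  induction t with
  | zero => simp
  | tmul n p => exact h m n p
  | add t s ht hs => simp only [TensorProduct.tmul_add, map_add, ht, hs]

theorem QB_addHom_ext {X : Type*} [AddCommGroup X] {F G : QB A B →+ X}
    (h : ∀ a a' : A, F (mkB A B (a ⊗ₜ[ℤ] a')) = G (mkB A B (a ⊗ₜ[ℤ] a'))) : F = G :=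
  QuotientAddGroup.addMonoidHom_ext _ (tensor_addHom_ext h)

theorem QB3_addHom_ext {X : Type*} [AddCommGroup X] {F G : QB3 A B →+ X}
    (h : ∀ a a' a'' : A, F (mkB3 A B (a ⊗ₜ[ℤ] (a' ⊗ₜ[ℤ] a''))) =
      G (mkB3 A B (a ⊗ₜ[ℤ] (a' ⊗ₜ[ℤ] a'')))) : F = G :=
  QuotientAddGroup.addMonoidHom_ext _ (tensor_addHom_ext₃ h)

theorem mkB3_balanced_left (a a' a'' : A) {b : A} (hb : b ∈ B) :
    mkB3 A B (a ⊗ₜ[ℤ] ((b * a') ⊗ₜ[ℤ] a'')) = mkB3 A B ((a * b) ⊗ₜ[ℤ] (a' ⊗ₜ[ℤ] a'')) :=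
  QuotientAddGroup.eq_iff_sub_mem.mpr <| by
    rw [← neg_sub]
    exact neg_mem (AddSubgroup.subset_closure (Or.inl ⟨a, a', a'', b, hb, rfl⟩))

theorem mkB3_balanced_right (a a' a'' : A) {b : A} (hb : b ∈ B) :
    mkB3 A B (a ⊗ₜ[ℤ] (a' ⊗ₜ[ℤ] (b * a''))) = mkB3 A B (a ⊗ₜ[ℤ] ((a' * b) ⊗ₜ[ℤ] a'')) :=
  QuotientAddGroup.eq_iff_sub_mem.mpr <| by
    rw [← neg_sub]
    exact neg_mem (AddSubgroup.subset_closure (Or.inr ⟨a, a', a'', b, hb, rfl⟩))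

/-- The inclusion of `S` in `E`. -/
def sgrpToEgrp (α : Sgrp A B) : Egrp A B := ⟨α, fun b hb a => (α.2 b hb a).1⟩

@[simp]
theorem sgrpToEgrp_apply (α : Sgrp A B) (a : A) :
    (sgrpToEgrp α : A →+ A) a = (α : A →+ A) a := rfl

/-- `α(−)r` for `r` centralizing `B`. -/
def sgrpMulRight (α : Sgrp A B) (r : A) (hr : r ∈ Set.centralizer (B : Set A)) : Sgrp A B :=
  ⟨(AddMonoidHom.mulRight r).comp α, fun b hb a => by
    simp [(α.2 b hb a).1, (α.2 b hb a).2, mul_assoc, hr b hb]⟩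

@[simp]
theorem sgrpMulRight_apply (α : Sgrp A B) (r : A) (hr : r ∈ Set.centralizer (B : Set A)) (a : A) :
    (sgrpMulRight α r hr : A →+ A) a = (α : A →+ A) a * r := rfl

/-- `r·α(−)` for `r` centralizing `B`. -/
def sgrpMulLeft (α : Sgrp A B) (r : A) (hr : r ∈ Set.centralizer (B : Set A)) : Sgrp A B :=
  ⟨(AddMonoidHom.mulLeft r).comp α, fun b hb a => by
    have hbr : b * r = r * b := hr b hb
    simp [(α.2 b hb a).1, (α.2 b hb a).2, ← mul_assoc, hbr]⟩

@[simp]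
theorem sgrpMulLeft_apply (α : Sgrp A B) (r : A) (hr : r ∈ Set.centralizer (B : Set A)) (a : A) :
    (sgrpMulLeft α r hr : A →+ A) a = r * (α : A →+ A) a := rfl

/-- The map `A ⊗_B A → A`, `x ⊗ y ↦ x f(y)`, for `f ∈ E`. -/
def evalMid (f : Egrp A B) : QB A B →+ A :=
  QuotientAddGroup.lift _
    (liftBiadditive (fun x y => x * (f : A →+ A) y) (fun _ _ _ => add_mul _ _ _)
      (fun _ _ _ => by rw [map_add, mul_add]))
    (by
      rw [relB, AddSubgroup.closure_le]
      rintro z ⟨a, a', b, hb, rfl⟩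
      simp [f.2 b hb, mul_assoc])

@[simp]
theorem evalMid_mkB (f : Egrp A B) (x y : A) :
    evalMid f (mkB A B (x ⊗ₜ[ℤ] y)) = x * (f : A →+ A) y := rfl

@[simp]
theorem lmulB_mkB (c x y : A) :
    lmulB A B c (mkB A B (x ⊗ₜ[ℤ] y)) = mkB A B ((c * x) ⊗ₜ[ℤ] y) := rfl

@[simp]
theorem rmulB_mkB (c x y : A) :
    rmulB A B c (mkB A B (x ⊗ₜ[ℤ] y)) = mkB A B (x ⊗ₜ[ℤ] (y * c)) := rfl

@[simp]
theorem lmulB3_mkB3 (c x y z : A) :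
    lmulB3 A B c (mkB3 A B (x ⊗ₜ[ℤ] (y ⊗ₜ[ℤ] z))) =
      mkB3 A B ((c * x) ⊗ₜ[ℤ] (y ⊗ₜ[ℤ] z)) := rfl

theorem evalMid_add (f g : Egrp A B) (q : QB A B) :
    evalMid (f + g) q = evalMid f q + evalMid g q :=
  DFunLike.congr_fun (QB_addHom_ext (F := evalMid (f + g)) (G := evalMid f + evalMid g)
    fun x y => by simp [mul_add]) q

theorem evalMid_lmulB (f : Egrp A B) (c : A) (q : QB A B) :
    evalMid f (lmulB A B c q) = c * evalMid f q :=
  DFunLike.congr_fun (QB_addHom_ext (F := (evalMid f).comp (lmulB A B c))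
    (G := (AddMonoidHom.mulLeft c).comp (evalMid f)) fun x y => by simp [mul_assoc]) q

theorem evalMid_rmulB {f g : Egrp A B} {c : A}
    (h : ∀ x, (g : A →+ A) x = (f : A →+ A) (x * c)) (q : QB A B) :
    evalMid f (rmulB A B c q) = evalMid g q :=
  DFunLike.congr_fun (QB_addHom_ext (F := (evalMid f).comp (rmulB A B c))
    (G := evalMid g) fun x y => by simp [h]) q

theorem evalMid_mul_right {f g : Egrp A B} {c : A}
    (h : ∀ x, (g : A →+ A) x = (f : A →+ A) x * c) (q : QB A B) :
    evalMid g q = evalMid f q * c :=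
  DFunLike.congr_fun (QB_addHom_ext (F := evalMid g)
    (G := (AddMonoidHom.mulRight c).comp (evalMid f)) fun x y => by simp [h, mul_assoc]) q

theorem evalMid_mem_centralizer (α : Sgrp A B) {u : QB A B}
    (hu : ∀ b ∈ B, lmulB A B b u = rmulB A B b u) :
    evalMid (sgrpToEgrp α) u ∈ Set.centralizer (B : Set A) := by
  intro b hb
  let αb : Egrp A B := ⟨(AddMonoidHom.mulRight b).comp α, fun c hc a => by
    simp [(α.2 c hc a).1, mul_assoc]⟩
  rw [← evalMid_lmulB, hu b hb,
    evalMid_rmulB (f := sgrpToEgrp α) (g := αb) fun x => ((α.2 b hb x).2).symm,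
    evalMid_mul_right (f := sgrpToEgrp α) fun x => rfl]

/-- Contraction of a family of elements of `E` against a `B`-central element of `A ⊗_B A`. -/
def contract (u : QB A B) (hu : ∀ b ∈ B, lmulB A B b u = rmulB A B b u) (P : A →+ Egrp A B)
    (hP : ∀ b ∈ B, ∀ x z, (P (b * x) : A →+ A) z = (P x : A →+ A) (z * b)) : Egrp A B :=
  ⟨AddMonoidHom.mk' (fun x => evalMid (P x) u) (fun x y => by rw [map_add, evalMid_add]),
    fun b hb x => by
      simp only [AddMonoidHom.mk'_apply]
      rw [← evalMid_lmulB, hu b hb, evalMid_rmulB (hP b hb x)]⟩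

@[simp]
theorem contract_apply (u : QB A B) (hu : ∀ b ∈ B, lmulB A B b u = rmulB A B b u)
    (P : A →+ Egrp A B)
    (hP : ∀ b ∈ B, ∀ x z, (P (b * x) : A →+ A) z = (P x : A →+ A) (z * b)) (x : A) :
    (contract u hu P hP : A →+ A) x = evalMid (P x) u := rfl

/-- The element `F(− ⊗ x ⊗ y)` of `E`. -/
def slice (F : HomBQ3 A B) (x y : A) : Egrp A B :=
  ⟨AddMonoidHom.mk' (fun z => (F : QB3 A B →+ A) (mkB3 A B (z ⊗ₜ[ℤ] (x ⊗ₜ[ℤ] y))))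
      (fun z z' => by simp [TensorProduct.add_tmul]),
    fun b hb z => F.2 b hb (mkB3 A B (z ⊗ₜ[ℤ] (x ⊗ₜ[ℤ] y)))⟩

@[simp]
theorem slice_apply (F : HomBQ3 A B) (x y z : A) :
    (slice F x y : A →+ A) z = (F : QB3 A B →+ A) (mkB3 A B (z ⊗ₜ[ℤ] (x ⊗ₜ[ℤ] y))) := rfl

theorem Egrp_ext {f g : Egrp A B} (h : ∀ a, (f : A →+ A) a = (g : A →+ A) a) : f = g :=
  Subtype.ext (AddMonoidHom.ext h)

theorem slice_add (F G : HomBQ3 A B) (x y : A) : slice (F + G) x y = slice F x y + slice G x y :=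
  Egrp_ext fun _ => rfl

/-- For `u = u¹ ⊗ u²` central, the element `u¹ F(u² ⊗ − ⊗ y)` of `E`. -/
def contractFirst (u : QB A B) (hu : ∀ b ∈ B, lmulB A B b u = rmulB A B b u) (F : HomBQ3 A B)
    (y : A) : Egrp A B :=
  contract u hu
    (AddMonoidHom.mk' (fun x => slice F x y) fun x x' => Egrp_ext fun z => by
      simp [TensorProduct.add_tmul, TensorProduct.tmul_add])
    (fun b hb x z => by simp [mkB3_balanced_left z x y hb])

@[simp]
theorem contractFirst_apply (u : QB A B) (hu : ∀ b ∈ B, lmulB A B b u = rmulB A B b u)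
    (F : HomBQ3 A B) (x y : A) :
    (contractFirst u hu F y : A →+ A) x = evalMid (slice F x y) u := rfl

/-- For `u = u¹ ⊗ u²` and `v = v¹ ⊗ v²` central, the element `v¹ u¹ F(u² ⊗ v² ⊗ −)` of `E`. -/
def contractTwice (u v : QB A B) (hu : ∀ b ∈ B, lmulB A B b u = rmulB A B b u)
    (hv : ∀ b ∈ B, lmulB A B b v = rmulB A B b v) (F : HomBQ3 A B) : Egrp A B :=
  contract v hv
    (AddMonoidHom.mk' (contractFirst u hu F) fun y y' => Egrp_ext fun x => by
      have : slice F x (y + y') = slice F x y + slice F x y' := Egrp_ext fun z => by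
        simp [TensorProduct.tmul_add]
      simp [this, evalMid_add])
    (fun b hb y x => by
      have : slice F x (b * y) = slice F (x * b) y := Egrp_ext fun z => by
        simp [mkB3_balanced_right z x y hb]
      simp [this])

@[simp]
theorem contractTwice_apply (u v : QB A B) (hu : ∀ b ∈ B, lmulB A B b u = rmulB A B b u)
    (hv : ∀ b ∈ B, lmulB A B b v = rmulB A B b v) (F : HomBQ3 A B) (y : A) :
    (contractTwice u v hu hv F : A →+ A) y = evalMid (contractFirst u hu F y) v := rfl

theorem contractTwice_add (u v : QB A B) (hu : ∀ b ∈ B, lmulB A B b u = rmulB A B b u)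
    (hv : ∀ b ∈ B, lmulB A B b v = rmulB A B b v) (F G : HomBQ3 A B) :
    contractTwice u v hu hv (F + G) = contractTwice u v hu hv F + contractTwice u v hu hv G := by
  refine Egrp_ext fun y => ?_
  have : contractFirst u hu (F + G) y = contractFirst u hu F y + contractFirst u hu G y :=
    Egrp_ext fun x => by simp [slice_add, evalMid_add]
  simp [this, evalMid_add]

/-- The map `A ⊗_B A ⊗_B A → A`, `a ⊗ a' ⊗ a'' ↦ α(a) β(a') f(a'')`. -/
def prodAddHom (α β : Sgrp A B) (f : Egrp A B) : QB3 A B →+ A :=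
  QuotientAddGroup.lift _
    (liftTriadditive (fun a a' a'' => (α : A →+ A) a * (β : A →+ A) a' * (f : A →+ A) a'')
      (fun _ _ _ _ => by simp [add_mul]) (fun _ _ _ _ => by simp [mul_add, add_mul])
      (fun _ _ _ _ => by simp [mul_add]))
    (by
      rw [relB3, AddSubgroup.closure_le]
      rintro z (⟨a, a', a'', b, hb, rfl⟩ | ⟨a, a', a'', b, hb, rfl⟩)
      · simp [(α.2 b hb a).2, (β.2 b hb a').1, mul_assoc]
      · simp [(β.2 b hb a').2, f.2 b hb, mul_assoc])

@[simp]
theorem prodAddHom_mkB3 (α β : Sgrp A B) (f : Egrp A B) (a a' a'' : A) :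
    prodAddHom α β f (mkB3 A B (a ⊗ₜ[ℤ] (a' ⊗ₜ[ℤ] a''))) =
      (α : A →+ A) a * (β : A →+ A) a' * (f : A →+ A) a'' := rfl

/-- `prodAddHom` as an element of `Hom(_B A ⊗_B A ⊗_B A, _B A)`. -/
def prodHom (α β : Sgrp A B) (f : Egrp A B) : HomBQ3 A B :=
  ⟨prodAddHom α β f, fun b hb q => DFunLike.congr_fun (QB3_addHom_ext
    (F := (prodAddHom α β f).comp (lmulB3 A B b))
    (G := (AddMonoidHom.mulLeft b).comp (prodAddHom α β f)) fun x y z => by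
      simp [(α.2 b hb x).1, mul_assoc]) q⟩

@[simp]
theorem prodHom_mkB3 (α β : Sgrp A B) (f : Egrp A B) (a a' a'' : A) :
    (prodHom α β f : QB3 A B →+ A) (mkB3 A B (a ⊗ₜ[ℤ] (a' ⊗ₜ[ℤ] a''))) =
      (α : A →+ A) a * (β : A →+ A) a' * (f : A →+ A) a'' := rfl

theorem HomBQ3_ext {F G : HomBQ3 A B}
    (h : ∀ a a' a'' : A, (F : QB3 A B →+ A) (mkB3 A B (a ⊗ₜ[ℤ] (a' ⊗ₜ[ℤ] a''))) =
      (G : QB3 A B →+ A) (mkB3 A B (a ⊗ₜ[ℤ] (a' ⊗ₜ[ℤ] a'')))) : F = G :=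
  Subtype.ext (QB3_addHom_ext h)

variable (A B) in
/-- `S ⊗_R S ⊗_R E`. -/
abbrev QSSE := (Sgrp A B ⊗[ℤ] (Sgrp A B ⊗[ℤ] Egrp A B)) ⧸ relSSE A B

/-- The class of `α ⊗ β ⊗ f` in `S ⊗_R S ⊗_R E`. -/
def mkSSE (α β : Sgrp A B) (f : Egrp A B) : QSSE A B :=
  QuotientAddGroup.mk' (relSSE A B) (α ⊗ₜ[ℤ] (β ⊗ₜ[ℤ] f))

theorem mkSSE_balanced_left {α α' β β' : Sgrp A B} {f : Egrp A B} {r : A}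
    (hr : r ∈ Set.centralizer (B : Set A))
    (hα : ∀ a : A, (α' : A →+ A) a = (α : A →+ A) a * r)
    (hβ : ∀ a : A, (β' : A →+ A) a = r * (β : A →+ A) a) :
    mkSSE α' β f = mkSSE α β' f :=
  QuotientAddGroup.eq_iff_sub_mem.mpr
    (AddSubgroup.subset_closure (Or.inl ⟨α, α', β, β', f, r, hr, hα, hβ, rfl⟩))

theorem mkSSE_balanced_right {α β β' : Sgrp A B} {f f' : Egrp A B} {r : A}
    (hr : r ∈ Set.centralizer (B : Set A))
    (hβ : ∀ a : A, (β' : A →+ A) a = (β : A →+ A) a * r)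
    (hf : ∀ a : A, (f' : A →+ A) a = r * (f : A →+ A) a) :
    mkSSE α β' f = mkSSE α β f' :=
  QuotientAddGroup.eq_iff_sub_mem.mpr
    (AddSubgroup.subset_closure (Or.inr ⟨α, β, β', f, f', r, hr, hβ, hf, rfl⟩))

theorem mkSSE_add_right (α β : Sgrp A B) (f f' : Egrp A B) :
    mkSSE α β (f + f') = mkSSE α β f + mkSSE α β f' := by
  simp only [mkSSE, TensorProduct.tmul_add, map_add]

theorem mkSSE_sum_left {ι : Type*} (s : Finset ι) (α : ι → Sgrp A B) (β : Sgrp A B)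
    (f : Egrp A B) : mkSSE (∑ i ∈ s, α i) β f = ∑ i ∈ s, mkSSE (α i) β f := by
  simp only [mkSSE, TensorProduct.sum_tmul, map_sum]

theorem mkSSE_sum_mid {ι : Type*} (s : Finset ι) (α : Sgrp A B) (β : ι → Sgrp A B)
    (f : Egrp A B) : mkSSE α (∑ i ∈ s, β i) f = ∑ i ∈ s, mkSSE α (β i) f := by
  simp only [mkSSE, TensorProduct.sum_tmul, TensorProduct.tmul_sum, map_sum]

variable (A B) in
/-- The map `S ⊗_R S ⊗_R E → Hom(_B A ⊗_B A ⊗_B A, _B A)` induced by `prodHom`. -/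
def prodMap : QSSE A B →+ HomBQ3 A B :=
  QuotientAddGroup.lift _
    (liftTriadditive prodHom (fun _ _ _ _ => HomBQ3_ext fun _ _ _ => by simp [add_mul])
      (fun _ _ _ _ => HomBQ3_ext fun _ _ _ => by simp [mul_add, add_mul])
      (fun _ _ _ _ => HomBQ3_ext fun _ _ _ => by simp [mul_add]))
    (by
      rw [relSSE, AddSubgroup.closure_le]
      rintro z (⟨α, α', β, β', f, r, hr, h, h', rfl⟩ | ⟨α, β, β', f, f', r, hr, h, h', rfl⟩) <;>
        exact HomBQ3_ext fun _ _ _ => by simp [h, h', mul_assoc])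

@[simp]
theorem prodMap_mkSSE (α β : Sgrp A B) (f : Egrp A B) :
    prodMap A B (mkSSE α β f) = prodHom α β f := rfl

section Quasibase

variable {n : ℕ} {γ : Fin n → Sgrp A B} {u : Fin n → QB A B}

theorem sum_mul_evalMid (hqb : ∀ a a' : A,
      mkB A B (a ⊗ₜ[ℤ] a') = ∑ j, lmulB A B (a * (γ j : A →+ A) a') (u j))
    (f : Egrp A B) (a : A) :
    ∑ j, (γ j : A →+ A) a * evalMid f (u j) = (f : A →+ A) a := by
  have := congrArg (evalMid f) (hqb 1 a)
  simpa [evalMid_lmulB] using this.symm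

/-- The inverse of `prodMap` determined by a right D2 quasibase. -/
def prodMapInv (γ : Fin n → Sgrp A B) (hu : ∀ j, ∀ b ∈ B, lmulB A B b (u j) = rmulB A B b (u j)) :
    HomBQ3 A B →+ QSSE A B :=
  AddMonoidHom.mk'
    (fun F => ∑ j, ∑ k, mkSSE (γ j) (γ k) (contractTwice (u j) (u k) (hu j) (hu k) F))
    (fun F G => by simp only [contractTwice_add, mkSSE_add_right, Finset.sum_add_distrib])

theorem prodMap_prodMapInv (hu : ∀ j, ∀ b ∈ B, lmulB A B b (u j) = rmulB A B b (u j))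
    (hqb : ∀ a a' : A,
      mkB A B (a ⊗ₜ[ℤ] a') = ∑ j, lmulB A B (a * (γ j : A →+ A) a') (u j))
    (F : HomBQ3 A B) : prodMap A B (prodMapInv γ hu F) = F := by
  refine HomBQ3_ext fun a a' a'' => ?_
  simp only [prodMapInv, AddMonoidHom.mk'_apply, map_sum, prodMap_mkSSE,
    AddSubgroup.val_finsetSum, AddMonoidHom.finsetSum_apply, prodHom_mkB3, contractTwice_apply,
    mul_assoc, ← Finset.mul_sum, sum_mul_evalMid hqb, contractFirst_apply, slice_apply]

theorem prodMapInv_prodHom (hu : ∀ j, ∀ b ∈ B, lmulB A B b (u j) = rmulB A B b (u j))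
    (hqb : ∀ a a' : A,
      mkB A B (a ⊗ₜ[ℤ] a') = ∑ j, lmulB A B (a * (γ j : A →+ A) a') (u j))
    (α β : Sgrp A B) (f : Egrp A B) : prodMapInv γ hu (prodHom α β f) = mkSSE α β f := by
  have sum_mulRight (δ : Sgrp A B) :
      ∑ j, sgrpMulRight (γ j) _ (evalMid_mem_centralizer δ (hu j)) = δ :=
    Subtype.ext <| AddMonoidHom.ext fun a => by
      simpa using sum_mul_evalMid hqb (sgrpToEgrp δ) a
  have key (j k : Fin n) :
      mkSSE (γ j) (γ k) (contractTwice (u j) (u k) (hu j) (hu k) (prodHom α β f)) =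
        mkSSE (γ j) (sgrpMulRight (γ k) _ (evalMid_mem_centralizer
          (sgrpMulLeft β _ (evalMid_mem_centralizer α (hu j))) (hu k))) f := by
    refine (mkSSE_balanced_right (evalMid_mem_centralizer _ (hu k)) (fun a => rfl)
      fun y => ?_).symm
    rw [contractTwice_apply]
    refine evalMid_mul_right (fun x => ?_) _
    rw [contractFirst_apply, sgrpToEgrp_apply, sgrpMulLeft_apply, mul_assoc]
    exact evalMid_mul_right (fun z => by simp [mul_assoc]) _
  simp only [prodMapInv, AddMonoidHom.mk'_apply, key, ← mkSSE_sum_mid, sum_mulRight]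
  conv_rhs => rw [← sum_mulRight α, mkSSE_sum_left]
  exact Finset.sum_congr rfl fun j _ =>
    (mkSSE_balanced_left (evalMid_mem_centralizer α (hu j)) (fun a => rfl) fun a => rfl).symm

end Quasibase

end

/-- given a right D2 quasibase `γ_j ∈ S`, `u_j ∈ T`, the map
`S ⊗_R S ⊗_R E → Hom(_B A ⊗_B A ⊗_B A, _B A)`,
`α ⊗ β ⊗ f ↦ (a ⊗ a' ⊗ a'' ↦ α(a) β(a') f(a''))`, is well defined and bijective. -/
theorem statement2 (n : ℕ) (γ : Fin n → ↥(Sgrp A B)) (u : Fin n → QB A B)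
    (hu : ∀ j, ∀ b ∈ B, lmulB A B b (u j) = rmulB A B b (u j))
    (hqb : ∀ a a' : A,
      mkB A B (a ⊗ₜ[ℤ] a') = ∑ j, lmulB A B (a * (γ j : A →+ A) a') (u j)) :
    ∃ Φ : (↥(Sgrp A B) ⊗[ℤ] (↥(Sgrp A B) ⊗[ℤ] ↥(Egrp A B))) ⧸ relSSE A B →+ ↥(HomBQ3 A B),
      (∀ (α β : ↥(Sgrp A B)) (f : ↥(Egrp A B)) (a a' a'' : A),
        ((Φ ((QuotientAddGroup.mk' _) (α ⊗ₜ[ℤ] (β ⊗ₜ[ℤ] f))) : QB3 A B →+ A))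
            (mkB3 A B (a ⊗ₜ[ℤ] (a' ⊗ₜ[ℤ] a'')))
          = (α : A →+ A) a * (β : A →+ A) a' * (f : A →+ A) a'') ∧
      Function.Bijective Φ := by
  refine ⟨prodMap A B, fun α β f a a' a'' => rfl, ?_⟩
  refine Function.bijective_iff_has_inverse.mpr
    ⟨prodMapInv γ hu, fun q => ?_, prodMap_prodMapInv hu hqb⟩
  have : (prodMapInv γ hu).comp (prodMap A B) = AddMonoidHom.id _ :=
    QuotientAddGroup.addMonoidHom_ext _ (tensor_addHom_ext₃ (prodMapInv_prodHom hu hqb))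
  exact DFunLike.congr_fun this q
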